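/- arXiv:2206.08648 — 4 statements merged into one kernel-verified Lean document; each statement's English description precedes it below -/
import Mathlib

section
/- Fix ν ∈ ℕ₀ and let n ∈ ℕ with n ≥ 1. Define the truncation-error kernel e_n(t,u) = ∑_{m=n}^∞ [ψ⁻_{m,ν}(t) ψ⁻_{m,ν}(u) + ψ⁺_{m,ν}(t) ψ⁺_{m,ν}(u)]. Then (∫_ℝ ∫_ℝ e_n(t,u)² w_ν(t) w_ν(u) dt du)^{1/2} ≤ c_ν / n^{ν+1/2}, where c_ν = ((ν!)²/(2ν)!) · √(2(2ν+2)/(2ν+1)). -/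
open Real Finset MeasureTheory

/-- The associated Laguerre polynomial `L_m^{(η)}(x) = ∑_{k=0}^m C(m+η, m−k)(−1)^k x^k/k!`. -/
noncomputable def assocLagPoly (m η : ℕ) (x : ℝ) : ℝ :=
  ∑ k ∈ Finset.range (m + 1),
    (Nat.choose (m + η) (m - k) : ℝ) * (-1) ^ k / (Nat.factorial k : ℝ) * x ^ k

/-- The Matérn–Laguerre functions `ψ⁺_{m,ν}` supported on the nonnegative half-line. -/
noncomputable def psiPlus (ν m : ℕ) (t : ℝ) : ℝ :=
  Set.indicator (Set.Ici (0 : ℝ))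
    (fun s =>
      ((Nat.factorial ν : ℝ) / Real.sqrt (Nat.factorial (2 * ν))) *
        ((Nat.factorial m : ℝ) / (Nat.factorial (m + ν + 1) : ℝ)) *
        (2 * s) ^ (ν + 1) * assocLagPoly m (ν + 1) (2 * s) * Real.exp (-s)) t

/-- The Matérn–Laguerre functions `ψ⁻_{m,ν}(t) = (−1)^ν ψ⁺_{m,ν}(−t)`. -/
noncomputable def psiMinus (ν m : ℕ) (t : ℝ) : ℝ := (-1) ^ ν * psiPlus ν m (-t)

/-- The weight function `w_ν(t) = 2/|2t|^{ν+1}`. -/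
noncomputable def wMatern (ν : ℕ) (t : ℝ) : ℝ := 2 / |2 * t| ^ (ν + 1)

/-- The truncation-error kernel `e_n(t,u) = ∑_{m=n}^∞ [ψ⁻_m(t)ψ⁻_m(u) + ψ⁺_m(t)ψ⁺_m(u)]`. -/
noncomputable def maternTail (ν n : ℕ) (t u : ℝ) : ℝ :=
  ∑' m : ℕ,
    (psiMinus ν (n + m) t * psiMinus ν (n + m) u +
      psiPlus ν (n + m) t * psiPlus ν (n + m) u)

noncomputable def lagC (m a k : ℕ) : ℝ :=
  (Nat.choose (m + a) (m - k) : ℝ) * (-1) ^ k / (Nat.factorial k : ℝ)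

lemma lagC_factorial (m a i j : ℕ) (hi : i ≤ m) :
    lagC m a i * ((a + i + j).factorial : ℝ) =
      ((m + a).factorial : ℝ) / m.factorial * ((-1) ^ i * (m.choose i : ℝ) *
        ((ascPochhammer ℝ j).comp (Polynomial.X + Polynomial.C (a + 1 : ℝ))).eval (i : ℝ)) := by
  have h1 : ((ascPochhammer ℝ j).comp (Polynomial.X + Polynomial.C (a + 1 : ℝ))).eval (i : ℝ)
      = ((a + i + 1).ascFactorial j : ℝ) := by
    rw [← ascPochhammer_nat_eq_ascFactorial, ascPochhammer_eval_cast]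
    simp only [Polynomial.eval_comp, Polynomial.eval_add, Polynomial.eval_X, Polynomial.eval_C]
    congr 1
    push_cast
    ring
  rw [h1, ← Nat.factorial_mul_ascFactorial (a + i) j]
  unfold lagC
  rw [Nat.cast_choose ℝ (show m - i ≤ m + a by omega), Nat.cast_choose ℝ hi,
    show m + a - (m - i) = a + i by omega]
  have := Nat.factorial_pos
  push_cast
  have e1 : ((m - i).factorial : ℝ) ≠ 0 := by positivity
  have e2 : ((a + i).factorial : ℝ) ≠ 0 := by positivity
  have e3 : ((i).factorial : ℝ) ≠ 0 := by positivity
  have e4 : ((m).factorial : ℝ) ≠ 0 := by positivity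
  field_simp

lemma lag_moment (m a j : ℕ) (hj : j ≤ m) :
    ∑ i ∈ Finset.range (m + 1), lagC m a i * ((a + i + j).factorial : ℝ) =
      if j = m then (-1) ^ m * ((m + a).factorial : ℝ) else 0 := by
  rw [Finset.sum_congr rfl (fun i hi => lagC_factorial m a i j
    (by have := Finset.mem_range.mp hi; omega)), ← Finset.mul_sum]
  set P := (ascPochhammer ℝ j).comp (Polynomial.X + Polynomial.C (a + 1 : ℝ)) with hP
  have hm : P.Monic := (monic_ascPochhammer ℝ j).comp_X_add_C _
  have hd : P.natDegree = j := by
    rw [hP, Polynomial.natDegree_comp, ascPochhammer_natDegree, Polynomial.natDegree_X_add_C,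
      mul_one]
  have h2 := fwdDiff_iter_eq_sum_shift (1 : ℝ) (fun x => P.eval x) m 0
  have h3 : ∑ i ∈ Finset.range (m + 1), (-1) ^ i * (m.choose i : ℝ) * P.eval (i : ℝ)
      = (-1) ^ m * ((fwdDiff (1 : ℝ))^[m] (fun x => P.eval x) 0) := by
    rw [h2, Finset.mul_sum]
    refine Finset.sum_congr rfl fun i hi => ?_
    have hi' : i ≤ m := by have := Finset.mem_range.mp hi; omega
    obtain ⟨k, rfl⟩ := Nat.exists_eq_add_of_le hi'
    have : ((-1 : ℝ) ^ k) * (-1) ^ k = 1 := by rw [← mul_pow]; simp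
    simp only [zero_add, nsmul_eq_mul, mul_one, zsmul_eq_mul, Nat.add_sub_cancel_left]
    push_cast
    rw [pow_add]
    linear_combination (-(-1) ^ i * ((i + k).choose i : ℝ) * P.eval (i : ℝ)) * this
  rw [h3]
  split_ifs with h
  · have h4 := P.fwdDiff_iter_degree_eq_factorial
    rw [hd, h, hm.leadingCoeff] at h4
    have := congrFun h4 0
    have h5 : ((fwdDiff (1 : ℝ))^[m] (fun x => P.eval x) 0) = (m.factorial : ℝ) := by
      rw [this]; simp
    rw [h5]
    have e4 : ((m).factorial : ℝ) ≠ 0 := by positivity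
    field_simp
  · have h4 := Polynomial.fwdDiff_iter_eq_zero_of_degree_lt (P := P) (n := m) (by omega)
    have := congrFun h4 0
    have h5 : ((fwdDiff (1 : ℝ))^[m] (fun x => P.eval x) 0) = 0 := by
      rw [this]; simp
    rw [h5]; simp

lemma lag_orth_le (m k a : ℕ) (hk : k ≤ m) :
    ∑ j ∈ Finset.range (k + 1), ∑ i ∈ Finset.range (m + 1),
      lagC k a j * lagC m a i * ((a + i + j).factorial : ℝ) =
      if k = m then ((m + a).factorial : ℝ) / m.factorial else 0 := by
  have : ∀ j ∈ Finset.range (k + 1), ∑ i ∈ Finset.range (m + 1),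
      lagC k a j * lagC m a i * ((a + i + j).factorial : ℝ) =
      lagC k a j * (if j = m then (-1) ^ m * ((m + a).factorial : ℝ) else 0) := by
    intro j hj
    rw [← lag_moment m a j (by have := Finset.mem_range.mp hj; omega), Finset.mul_sum]
    exact Finset.sum_congr rfl fun i _ => by ring
  rw [Finset.sum_congr rfl this]
  split_ifs with h
  · subst h
    rw [Finset.sum_eq_single k]
    · simp only [if_true, lagC, Nat.sub_self, Nat.choose_zero_right]
      have : ((-1 : ℝ) ^ k) * (-1) ^ k = 1 := by rw [← mul_pow]; simp
      have e4 : ((k).factorial : ℝ) ≠ 0 := by positivity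
      push_cast
      field_simp
      linear_combination this
    · intro b _ hb; simp [hb]
    · intro h; simp at h
  · refine Finset.sum_eq_zero fun j hj => ?_
    have : j ≠ m := by have := Finset.mem_range.mp hj; omega
    simp [this]

lemma lag_orth (m k a : ℕ) :
    ∑ j ∈ Finset.range (k + 1), ∑ i ∈ Finset.range (m + 1),
      lagC k a j * lagC m a i * ((a + i + j).factorial : ℝ) =
      if k = m then ((m + a).factorial : ℝ) / m.factorial else 0 := by
  rcases le_total k m with h | h
  · exact lag_orth_le m k a h
  · rw [Finset.sum_comm]
    have := lag_orth_le k m a h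
    rw [show (if k = m then ((m + a).factorial : ℝ) / m.factorial else 0) =
      if m = k then ((k + a).factorial : ℝ) / k.factorial else 0 by
        by_cases h : k = m
        · simp [h]
        · simp [h, Ne.symm h], ← this]
    exact Finset.sum_congr rfl fun i _ => Finset.sum_congr rfl fun j _ => by
      rw [show a + i + j = a + j + i by ring]; ring

lemma gInt (k : ℕ) : ∫ t in Set.Ioi (0 : ℝ), 2 * (2 * t) ^ k * Real.exp (-(2 * t)) =
    (k.factorial : ℝ) := by
  have h := Real.Gamma_eq_integral (s := (k : ℝ) + 1) (by positivity)
  rw [Real.Gamma_nat_eq_factorial] at h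
  have h2 := integral_comp_mul_left_Ioi' (fun x : ℝ => Real.exp (-x) * x ^ k) 0 (b := 2) two_pos
  rw [mul_zero] at h2
  rw [h]
  have : ∫ x in Set.Ioi (0 : ℝ), Real.exp (-x) * x ^ ((k : ℝ) + 1 - 1) =
      ∫ x in Set.Ioi (0 : ℝ), Real.exp (-x) * x ^ k := by
    simp
  rw [this, ← h2, smul_eq_mul, ← integral_const_mul]
  congr 1
  ext t
  ring

lemma gIntegrable (k : ℕ) :
    IntegrableOn (fun t : ℝ => 2 * (2 * t) ^ k * Real.exp (-(2 * t))) (Set.Ioi 0) := by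
  refine Integrable.of_integral_ne_zero ?_
  rw [gInt]
  positivity

noncomputable def cst (ν m : ℕ) : ℝ :=
  ((Nat.factorial ν : ℝ) / Real.sqrt (Nat.factorial (2 * ν))) *
        ((Nat.factorial m : ℝ) / (Nat.factorial (m + ν + 1) : ℝ))

noncomputable def lam (ν m : ℕ) : ℝ :=
  ((Nat.factorial ν : ℝ) ^ 2 / (Nat.factorial (2 * ν))) *
        ((Nat.factorial m : ℝ) / (Nat.factorial (m + ν + 1) : ℝ))

lemma psi_prod (ν m k : ℕ) : (fun t => psiPlus ν m t * psiPlus ν k t * wMatern ν t) =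
    Set.indicator (Set.Ioi (0 : ℝ)) (fun t =>
      ∑ j ∈ Finset.range (k + 1), ∑ i ∈ Finset.range (m + 1),
        (cst ν m * cst ν k * (lagC k (ν + 1) j * lagC m (ν + 1) i)) *
          (2 * (2 * t) ^ (ν + 1 + i + j) * Real.exp (-(2 * t)))) := by
  ext t
  rcases lt_trichotomy t 0 with h | h | h
  · rw [Set.indicator_of_notMem (by simpa using h.le)]
    simp [psiPlus, h]
  · subst h
    simp [psiPlus]
  · rw [Set.indicator_of_mem (by simpa using h)]
    have h' : t ∈ Set.Ici (0 : ℝ) := h.le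
    simp only [psiPlus, Set.indicator_of_mem h', wMatern, assocLagPoly]
    rw [abs_of_pos (by positivity)]
    have hE : Real.exp (-(2 * t)) = Real.exp (-t) * Real.exp (-t) := by
      rw [← Real.exp_add]; ring_nf
    have hS : ∀ x : ℝ, ∑ j ∈ Finset.range (k + 1), ∑ i ∈ Finset.range (m + 1),
        (cst ν m * cst ν k * (lagC k (ν + 1) j * lagC m (ν + 1) i)) *
          (2 * x ^ (ν + 1 + i + j) * Real.exp (-(2 * t)))
        = cst ν m * cst ν k * 2 * x ^ (ν + 1) * Real.exp (-(2 * t)) *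
          ((∑ j ∈ Finset.range (k + 1), lagC k (ν + 1) j * x ^ j) *
           (∑ i ∈ Finset.range (m + 1), lagC m (ν + 1) i * x ^ i)) := by
      intro x
      rw [Finset.sum_mul_sum, Finset.mul_sum]
      refine Finset.sum_congr rfl fun j _ => ?_
      rw [Finset.mul_sum]
      refine Finset.sum_congr rfl fun i _ => ?_
      rw [pow_add, pow_add]; ring
    rw [hS, hE]
    simp only [lagC, cst]
    have hx : (2 * t) ≠ 0 := by positivity
    generalize 2 * t = x at *
    generalize (∑ j ∈ Finset.range (k + 1), _ : ℝ) = U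
    generalize (∑ j ∈ Finset.range (m + 1), _ : ℝ) = V
    generalize (k.factorial : ℝ) / _ = c1
    generalize (m.factorial : ℝ) / _ = c2
    generalize (ν.factorial : ℝ) / _ = c3
    field_simp

lemma psi_int (ν m k : ℕ) : Integrable (fun t => psiPlus ν m t * psiPlus ν k t * wMatern ν t) := by
  rw [psi_prod, integrable_indicator_iff measurableSet_Ioi]
  exact integrable_finsetSum _ fun j _ => integrable_finsetSum _ fun i _ =>
    (gIntegrable _).const_mul _

lemma psi_orth (ν m k : ℕ) : ∫ t, psiPlus ν m t * psiPlus ν k t * wMatern ν t =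
    if m = k then lam ν m else 0 := by
  rw [psi_prod, integral_indicator measurableSet_Ioi, integral_finsetSum _ fun j _ =>
    integrable_finsetSum _ fun i _ => (gIntegrable _).const_mul _]
  have : ∀ j ∈ Finset.range (k + 1), ∫ t in Set.Ioi (0 : ℝ), ∑ i ∈ Finset.range (m + 1),
        (cst ν m * cst ν k * (lagC k (ν + 1) j * lagC m (ν + 1) i)) *
          (2 * (2 * t) ^ (ν + 1 + i + j) * Real.exp (-(2 * t)))
      = cst ν m * cst ν k * ∑ i ∈ Finset.range (m + 1),
        lagC k (ν + 1) j * lagC m (ν + 1) i * ((ν + 1 + i + j).factorial : ℝ) := by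
    intro j _
    rw [integral_finsetSum _ fun i _ => (gIntegrable _).const_mul _, Finset.mul_sum]
    refine Finset.sum_congr rfl fun i _ => ?_
    rw [integral_const_mul, gInt]
    ring
  rw [Finset.sum_congr rfl this, ← Finset.mul_sum, lag_orth]
  by_cases h : k = m
  · subst h
    simp only [if_true, cst, lam]
    have hs : Real.sqrt ((2 * ν).factorial : ℝ) * Real.sqrt ((2 * ν).factorial : ℝ) =
      ((2 * ν).factorial : ℝ) := Real.mul_self_sqrt (by positivity)
    have e4 : ((k).factorial : ℝ) ≠ 0 := by positivity
    have e5 : ((k + ν + 1).factorial : ℝ) ≠ 0 := by positivity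
    have e6 : Real.sqrt ((2 * ν).factorial : ℝ) ≠ 0 := by positivity
    rw [← add_assoc]
    generalize Real.sqrt ((2 * ν).factorial : ℝ) = r at *
    rw [← hs]
    field_simp
  · simp [h, Ne.symm h]

noncomputable def phi (ν n : ℕ) (p : Bool × ℕ) : ℝ → ℝ :=
  if p.1 then psiPlus ν (n + p.2) else psiMinus ν (n + p.2)

lemma psi_cross (ν m k : ℕ) (t : ℝ) : psiPlus ν m t * psiPlus ν k (-t) = 0 := by
  rcases lt_trichotomy t 0 with h | h | h
  · simp [psiPlus, h]
  · subst h; simp [psiPlus]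
  · simp [psiPlus, h]

lemma minus_prod (ν m k : ℕ) (t : ℝ) : psiMinus ν m t * psiMinus ν k t * wMatern ν t =
    psiPlus ν m (-t) * psiPlus ν k (-t) * wMatern ν (-t) := by
  have : ((-1 : ℝ) ^ ν) * (-1) ^ ν = 1 := by rw [← mul_pow]; simp
  have h2 : wMatern ν (-t) = wMatern ν t := by simp [wMatern]
  rw [h2, psiMinus, psiMinus]
  linear_combination (psiPlus ν m (-t) * psiPlus ν k (-t) * wMatern ν t) * this

lemma phi_int (ν n : ℕ) (p q : Bool × ℕ) :
    Integrable (fun t => phi ν n p t * phi ν n q t * wMatern ν t) := by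
  obtain ⟨b, m⟩ := p
  obtain ⟨c, k⟩ := q
  cases b <;> cases c <;> simp only [phi, if_true, Bool.false_eq_true, if_false]
  · simp only [minus_prod]
    exact (psi_int ν (n + m) (n + k)).comp_neg
  · have : ∀ t, psiMinus ν (n + m) t * psiPlus ν (n + k) t * wMatern ν t = 0 := fun t => by
      rw [psiMinus]; linear_combination ((-1) ^ ν * wMatern ν t) * psi_cross ν (n + k) (n + m) t
    simp [this]
  · have : ∀ t, psiPlus ν (n + m) t * psiMinus ν (n + k) t * wMatern ν t = 0 := fun t => by
      rw [psiMinus]; linear_combination ((-1) ^ ν * wMatern ν t) * psi_cross ν (n + m) (n + k) t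
    simp [this]
  · exact psi_int _ _ _

lemma phi_orth (ν n : ℕ) (p q : Bool × ℕ) :
    ∫ t, phi ν n p t * phi ν n q t * wMatern ν t = if p = q then lam ν (n + p.2) else 0 := by
  obtain ⟨b, m⟩ := p
  obtain ⟨c, k⟩ := q
  cases b <;> cases c <;> simp only [phi, if_true, Bool.false_eq_true, if_false]
  · simp only [minus_prod]
    rw [integral_neg_eq_self (fun t => psiPlus ν (n + m) t * psiPlus ν (n + k) t * wMatern ν t),
      psi_orth]
    simp
  · have : ∀ t, psiMinus ν (n + m) t * psiPlus ν (n + k) t * wMatern ν t = 0 := fun t => by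
      rw [psiMinus]; linear_combination ((-1) ^ ν * wMatern ν t) * psi_cross ν (n + k) (n + m) t
    simp [this]
  · have : ∀ t, psiPlus ν (n + m) t * psiMinus ν (n + k) t * wMatern ν t = 0 := fun t => by
      rw [psiMinus]; linear_combination ((-1) ^ ν * wMatern ν t) * psi_cross ν (n + m) (n + k) t
    simp [this]
  · rw [psi_orth]; simp

lemma psi_meas (ν m : ℕ) : Measurable (psiPlus ν m) := by
  unfold psiPlus assocLagPoly
  refine Measurable.indicator ?_ measurableSet_Ici
  exact Continuous.measurable (by fun_prop)

lemma phi_meas (ν n : ℕ) (p : Bool × ℕ) : Measurable (phi ν n p) := by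
  unfold phi
  split_ifs
  · exact psi_meas _ _
  · exact ((psi_meas ν _).comp measurable_neg).const_mul _

lemma w_meas (ν : ℕ) : Measurable (wMatern ν) := by
  unfold wMatern
  fun_prop

lemma w_nonneg (ν : ℕ) (t : ℝ) : 0 ≤ wMatern ν t := by
  unfold wMatern
  positivity

lemma hs_norm {ι : Type*} [DecidableEq ι] (s : Finset ι) (φ : ι → ℝ → ℝ) (w : ℝ → ℝ) (l : ι → ℝ)
    (hint : ∀ i j, Integrable (fun t => φ i t * φ j t * w t))
    (horth : ∀ i j, ∫ t, φ i t * φ j t * w t = if i = j then l i else 0)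
    (hw : ∀ t, 0 ≤ w t) :
    ∫⁻ t, ∫⁻ u, ENNReal.ofReal ((∑ i ∈ s, φ i t * φ i u) ^ 2 * w t * w u) =
      ENNReal.ofReal (∑ i ∈ s, l i ^ 2) := by
  have hexp : ∀ t u, (∑ i ∈ s, φ i t * φ i u) ^ 2 * w t * w u =
      ∑ i ∈ s, ∑ j ∈ s, (φ i t * φ j t * w t) * (φ i u * φ j u * w u) := by
    intro t u
    rw [sq, Finset.sum_mul_sum, Finset.sum_mul, Finset.sum_mul]
    refine Finset.sum_congr rfl fun i _ => ?_
    rw [Finset.sum_mul, Finset.sum_mul]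
    refine Finset.sum_congr rfl fun j _ => ?_
    ring
  have hin : ∀ t, ∫⁻ u, ENNReal.ofReal ((∑ i ∈ s, φ i t * φ i u) ^ 2 * w t * w u) =
      ENNReal.ofReal (∑ i ∈ s, l i * (φ i t * φ i t * w t)) := by
    intro t
    rw [← ofReal_integral_eq_lintegral_ofReal]
    · congr 1
      simp only [hexp]
      rw [integral_finsetSum _ fun i _ => integrable_finsetSum _ fun j _ => (hint i j).const_mul _]
      refine Finset.sum_congr rfl fun i hi => ?_
      rw [integral_finsetSum _ fun j _ => (hint i j).const_mul _]
      simp only [integral_const_mul, horth]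
      simp [hi, mul_comm]
    · simp only [hexp]
      exact integrable_finsetSum _ fun i _ => integrable_finsetSum _ fun j _ => (hint i j).const_mul _
    · exact Filter.Eventually.of_forall fun u =>
        mul_nonneg (mul_nonneg (sq_nonneg _) (hw t)) (hw u)
  have hl : ∀ i, 0 ≤ l i := fun i => by
    have := horth i i
    rw [if_pos rfl] at this
    rw [← this]
    exact integral_nonneg fun t => mul_nonneg (mul_self_nonneg _) (hw t)
  simp only [hin]
  rw [← ofReal_integral_eq_lintegral_ofReal]
  · congr 1
    rw [integral_finsetSum _ fun i _ => (hint i i).const_mul _]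
    refine Finset.sum_congr rfl fun i hi => ?_
    rw [integral_const_mul, horth, if_pos rfl, sq]
  · exact integrable_finsetSum _ fun i _ => (hint i i).const_mul _
  · exact Filter.Eventually.of_forall fun t => Finset.sum_nonneg fun i _ =>
      mul_nonneg (hl i) (mul_nonneg (mul_self_nonneg _) (hw t))

lemma lam_le (ν m : ℕ) : lam ν m ≤
    ((Nat.factorial ν : ℝ) ^ 2 / (Nat.factorial (2 * ν))) * (1 / ((m : ℝ) + 1) ^ (ν + 1)) := by
  unfold lam
  refine mul_le_mul_of_nonneg_left ?_ (by positivity)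
  rw [div_le_div_iff₀ (by positivity) (by positivity), one_mul]
  exact_mod_cast Nat.factorial_mul_pow_le_factorial (m := m) (n := ν + 1)

lemma lam_nonneg (ν m : ℕ) : 0 ≤ lam ν m := by unfold lam; positivity

lemma step (p : ℕ) (x : ℝ) (hx : 0 < x) :
    p * (1 / (x + 1) ^ (p + 1)) ≤ 1 / x ^ p - 1 / (x + 1) ^ p := by
  have hb := one_add_mul_le_pow (a := 1 / x) (by have : 0 < 1 / x := by positivity
                                                 linarith) p
  have h1 : (1 + 1 / x) ^ p = (x + 1) ^ p / x ^ p := by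
    rw [← div_pow]; congr 1; field_simp
  rw [h1] at hb
  have h2 : (p : ℝ) / (x + 1) ≤ p * (1 / x) := by
    rw [mul_one_div]
    exact div_le_div_of_nonneg_left (by positivity) hx (by linarith)
  have h3 : 0 ≤ ((x + 1) ^ p / x ^ p - 1 - p / (x + 1)) / (x + 1) ^ p :=
    div_nonneg (by linarith) (by positivity)
  have h4 : ((x + 1) ^ p / x ^ p - 1 - p / (x + 1)) / (x + 1) ^ p =
      1 / x ^ p - 1 / (x + 1) ^ p - p * (1 / (x + 1) ^ (p + 1)) := by
    rw [pow_succ]; field_simp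
  linarith

lemma tail_sum (p n N : ℕ) (hn : 1 ≤ n) :
    p * ∑ m ∈ Finset.range N, (1 / (((n + m : ℕ) : ℝ) + 1) ^ (p + 1)) ≤
      1 / (n : ℝ) ^ p - 1 / ((n + N : ℕ) : ℝ) ^ p := by
  induction N with
  | zero => simp
  | succ N ih =>
    rw [Finset.sum_range_succ, mul_add]
    have := step p ((n + N : ℕ) : ℝ) (by positivity)
    have e : ((n + (N + 1) : ℕ) : ℝ) = ((n + N : ℕ) : ℝ) + 1 := by push_cast; ring
    rw [e]
    linarith

lemma lam_sum (ν n N : ℕ) (hn : 1 ≤ n) :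
    ∑ p ∈ (Finset.univ : Finset Bool) ×ˢ Finset.range N, lam ν (n + p.2) ^ 2 ≤
      ((Nat.factorial ν : ℝ) ^ 2 / (Nat.factorial (2 * ν))) ^ 2 *
        (2 * (2 * ν + 2) / (2 * ν + 1)) / (n : ℝ) ^ (2 * ν + 1) := by
  rw [Finset.sum_product]
  simp only [Fintype.sum_bool]
  set A := ((Nat.factorial ν : ℝ) ^ 2 / (Nat.factorial (2 * ν)))
  have h1 : ∑ m ∈ Finset.range N, lam ν (n + m) ^ 2 ≤
      A ^ 2 * ∑ m ∈ Finset.range N, (1 / (((n + m : ℕ) : ℝ) + 1) ^ (2 * ν + 1 + 1)) := by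
    rw [Finset.mul_sum]
    refine Finset.sum_le_sum fun m _ => ?_
    refine (pow_le_pow_left₀ (lam_nonneg _ _) (lam_le ν (n + m)) 2).trans (le_of_eq ?_)
    rw [mul_pow, div_pow 1, one_pow, ← pow_mul]
    congr 3
    ring
  have h2 := tail_sum (2 * ν + 1) n N hn
  set S := ∑ m ∈ Finset.range N, (1 / (((n + m : ℕ) : ℝ) + 1) ^ (2 * ν + 1 + 1))
  have h3 : 0 ≤ 1 / ((n + N : ℕ) : ℝ) ^ (2 * ν + 1) := by positivity
  have hn' : (0 : ℝ) < n := by exact_mod_cast hn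
  have h4 : S ≤ 1 / (n : ℝ) ^ (2 * ν + 1) / (2 * ν + 1) := by
    rw [le_div_iff₀ (by positivity)]
    push_cast at h2 h3
    linarith
  have h5 : S ≤ (2 * ν + 2) * (1 / (n : ℝ) ^ (2 * ν + 1) / (2 * ν + 1)) := by
    refine h4.trans (le_mul_of_one_le_left (by positivity) ?_)
    have : (0 : ℝ) ≤ ν := by positivity
    linarith
  have h6 := mul_le_mul_of_nonneg_left h5 (sq_nonneg A)
  have h7 : A ^ 2 * (2 * (2 * ν + 2) / (2 * ν + 1)) / (n : ℝ) ^ (2 * ν + 1) =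
    2 * (A ^ 2 * ((2 * ν + 2) * (1 / (n : ℝ) ^ (2 * ν + 1) / (2 * ν + 1)))) := by
    field_simp
  rw [h7]
  linarith

lemma partial_eq (ν n N : ℕ) (t u : ℝ) :
    ∑ p ∈ (Finset.univ : Finset Bool) ×ˢ Finset.range N, phi ν n p t * phi ν n p u =
    ∑ m ∈ Finset.range N, (psiMinus ν (n + m) t * psiMinus ν (n + m) u +
      psiPlus ν (n + m) t * psiPlus ν (n + m) u) := by
  rw [Finset.sum_product]
  simp [phi, Finset.sum_add_distrib, add_comm]

noncomputable def GN (ν n N : ℕ) (t u : ℝ) : ENNReal :=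
  ENNReal.ofReal ((∑ p ∈ (Finset.univ : Finset Bool) ×ˢ Finset.range N,
    phi ν n p t * phi ν n p u) ^ 2 * wMatern ν t * wMatern ν u)

lemma GN_meas (ν n N : ℕ) : Measurable (fun z : ℝ × ℝ => GN ν n N z.1 z.2) := by
  unfold GN
  have h1 := phi_meas ν n
  have h2 := w_meas ν
  refine Measurable.ennreal_ofReal ?_
  refine Measurable.mul (Measurable.mul (Measurable.pow_const ?_ 2) (h2.comp measurable_fst))
    (h2.comp measurable_snd)
  exact Finset.measurable_sum _ fun p _ =>
    ((h1 p).comp measurable_fst).mul ((h1 p).comp measurable_snd)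

lemma tail_le (ν n : ℕ) (t u : ℝ) :
    ‖maternTail ν n t u ^ 2 * wMatern ν t * wMatern ν u‖ₑ ≤
      Filter.liminf (fun N => GN ν n N t u) Filter.atTop := by
  rw [Real.enorm_of_nonneg (mul_nonneg (mul_nonneg (sq_nonneg _) (w_nonneg _ _)) (w_nonneg _ _))]
  by_cases hs : Summable (fun m : ℕ => psiMinus ν (n + m) t * psiMinus ν (n + m) u +
      psiPlus ν (n + m) t * psiPlus ν (n + m) u)
  · have h := hs.hasSum.tendsto_sum_nat
    have h2 : Filter.Tendsto (fun N => GN ν n N t u) Filter.atTop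
        (nhds (ENNReal.ofReal (maternTail ν n t u ^ 2 * wMatern ν t * wMatern ν u))) := by
      unfold GN
      simp only [partial_eq]
      exact ENNReal.tendsto_ofReal (((h.pow 2).mul_const _).mul_const _)
    rw [h2.liminf_eq]
  · rw [maternTail, tsum_eq_zero_of_not_summable hs]
    simp

lemma rhs_sq (ν n : ℕ) (A B : ℝ) (hB : 0 ≤ B) (hn' : (0 : ℝ) < n) :
    (A * Real.sqrt B / (n : ℝ) ^ ((ν : ℝ) + 1 / 2)) ^ 2 =
      A ^ 2 * B / (n : ℝ) ^ (2 * ν + 1) := by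
  rw [div_pow, mul_pow, Real.sq_sqrt hB]
  congr 1
  rw [← Real.rpow_mul_natCast hn'.le, ← Real.rpow_natCast]
  congr 1
  push_cast
  ring

lemma GN_le (ν n N : ℕ) (R : ℝ)
    (hR : ∑ p ∈ (Finset.univ : Finset Bool) ×ˢ Finset.range N, lam ν (n + p.2) ^ 2 ≤ R) :
    ∫⁻ t, ∫⁻ u, GN ν n N t u ≤ ENNReal.ofReal R := by
  unfold GN
  rw [hs_norm _ (phi ν n) (wMatern ν) (fun p => lam ν (n + p.2)) (phi_int ν n)
    (phi_orth ν n) (w_nonneg ν)]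
  exact ENNReal.ofReal_le_ofReal hR

lemma fatou2 (F : ℝ → ℝ → ℝ) (G : ℕ → ℝ → ℝ → ENNReal) (R : ℝ)
    (hm : ∀ N t, Measurable (fun u => G N t u))
    (hm2 : ∀ N, Measurable (fun t => ∫⁻ u, G N t u))
    (ht : ∀ t u, ‖F t u‖ₑ ≤ Filter.liminf (fun N => G N t u) Filter.atTop)
    (hG : ∀ N, ∫⁻ t, ∫⁻ u, G N t u ≤ ENNReal.ofReal R) :
    ‖∫ t : ℝ, ∫ u : ℝ, F t u‖ₑ ≤ ENNReal.ofReal R := by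
  have h1 : ‖∫ t : ℝ, ∫ u : ℝ, F t u‖ₑ ≤ ∫⁻ t, ‖∫ u : ℝ, F t u‖ₑ :=
    enorm_integral_le_lintegral_enorm _
  have h2 : ∫⁻ t, ‖∫ u : ℝ, F t u‖ₑ ≤ ∫⁻ t, ∫⁻ u, ‖F t u‖ₑ :=
    lintegral_mono fun t => enorm_integral_le_lintegral_enorm _
  have h3 : ∫⁻ t, ∫⁻ u, ‖F t u‖ₑ ≤
      ∫⁻ t, ∫⁻ u, Filter.liminf (fun N => G N t u) Filter.atTop :=
    lintegral_mono fun t => lintegral_mono fun u => ht t u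
  have h4 : ∫⁻ t, ∫⁻ u, Filter.liminf (fun N => G N t u) Filter.atTop ≤
      ∫⁻ t, Filter.liminf (fun N => ∫⁻ u, G N t u) Filter.atTop :=
    lintegral_mono fun t => lintegral_liminf_le fun N => hm N t
  have h5 : ∫⁻ t, Filter.liminf (fun N => ∫⁻ u, G N t u) Filter.atTop ≤
      Filter.liminf (fun N => ∫⁻ t, ∫⁻ u, G N t u) Filter.atTop :=
    lintegral_liminf_le hm2
  have h6 : Filter.liminf (fun N => ∫⁻ t, ∫⁻ u, G N t u) Filter.atTop ≤
      Filter.liminf (fun _ : ℕ => ENNReal.ofReal R) Filter.atTop :=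
    Filter.liminf_le_liminf (Filter.Eventually.of_forall hG)
  rw [Filter.liminf_const] at h6
  exact h1.trans (h2.trans (h3.trans (h4.trans (h5.trans h6))))

lemma le_of_enorm_le (x R : ℝ) (hR0 : 0 ≤ R) (h : ‖x‖ₑ ≤ ENNReal.ofReal R) : x ≤ R := by
  rw [Real.enorm_eq_ofReal_abs, ENNReal.ofReal_le_ofReal_iff hR0] at h
  exact (le_abs_self x).trans h

lemma meas_slice (f : ℝ → ℝ → ENNReal) (h : Measurable (fun z : ℝ × ℝ => f z.1 z.2)) (t : ℝ) :
    Measurable (fun u => f t u) :=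
  h.comp (measurable_prodMk_left (x := t))

lemma meas_int (f : ℝ → ℝ → ENNReal) (h : Measurable (fun z : ℝ × ℝ => f z.1 z.2)) :
    Measurable (fun t => ∫⁻ u, f t u) :=
  Measurable.lintegral_prod_right' (ν := volume) h

lemma main_le (ν n : ℕ) (R : ℝ)  (hR0 : 0 ≤ R)
    (hR : ∀ N, ∑ p ∈ (Finset.univ : Finset Bool) ×ˢ Finset.range N, lam ν (n + p.2) ^ 2 ≤ R) :
    ∫ t : ℝ, ∫ u : ℝ, maternTail ν n t u ^ 2 * wMatern ν t * wMatern ν u ≤ R := by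
  have hm : ∀ N t, Measurable (fun u => GN ν n N t u) := fun N t =>
    meas_slice (GN ν n N) (GN_meas ν n N) t
  have hm2 : ∀ N, Measurable (fun t => ∫⁻ u, GN ν n N t u) := fun N =>
    meas_int (GN ν n N) (GN_meas ν n N)
  have ht := tail_le ν n
  have hG := fun N => GN_le ν n N R (hR N)
  have h := fatou2 (fun t u => maternTail ν n t u ^ 2 * wMatern ν t * wMatern ν u)
    (GN ν n) R hm hm2 ht hG
  exact le_of_enorm_le _ R hR0 h

/-- Hilbert–Schmidt bound for the truncation error of the Matérn expansion. -/
theorem matern_truncation_error (ν n : ℕ) (hn : 1 ≤ n) :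
    Real.sqrt
        (∫ t : ℝ, ∫ u : ℝ, maternTail ν n t u ^ 2 * wMatern ν t * wMatern ν u) ≤
      ((Nat.factorial ν : ℝ) ^ 2 / (Nat.factorial (2 * ν) : ℝ)) *
          Real.sqrt (2 * (2 * ν + 2) / (2 * ν + 1)) /
        (n : ℝ) ^ ((ν : ℝ) + 1 / 2) := by
  have hn' : (0 : ℝ) < n := by exact_mod_cast hn
  refine Real.sqrt_le_iff.mpr ⟨by positivity, ?_⟩
  rw [rhs_sq ν n _ _ (by positivity) hn']
  exact main_le ν n _ (by positivity) (fun N => lam_sum ν n N hn)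
end

section
/- Define for m ∈ ℕ₀ the real-valued Cauchy–Laguerre functions α_m(t) = (1/√2)(ψ_m(t) + conj(ψ_m(t))) and β_m(t) = (1/(i√2))(ψ_m(t) − conj(ψ_m(t))). Then for every m ∈ ℕ₀ and every t ∈ ℝ: α_{2m}(t) = ((−1)^m t^{2m}/(t²+1)^{2m+1}) ∑_{k=0}^{m} C(2m+1, 2k)(−1)^k t^{2k}; α_{2m+1}(t) = ((−1)^m t^{2m+1}/(t²+1)^{2m+2}) ∑_{k=0}^{m} C(2m+2, 2k+1)(−1)^k t^{2k+1}; β_{2m}(t) = ((−1)^m t^{2m}/(t²+1)^{2m+1}) ∑_{k=0}^{m} C(2m+1, 2k+1)(−1)^k t^{2k+1}; and β_{2m+1}(t) = ((−1)^{m+1} t^{2m+1}/(t²+1)^{2m+2}) ∑_{k=0}^{m+1} C(2m+2, 2k)(−1)^k t^{2k}. -/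
open Real Complex Finset

/-- The complex-valued Cauchy–Laguerre functions of nonnegative index:
`ψ_m(t) = −(1/√2)(it)^m/(it−1)^{m+1}` for `m ∈ ℕ₀`. -/
noncomputable def cauchyLagPos (m : ℕ) (t : ℝ) : ℂ :=
  -(1 / (Real.sqrt 2 : ℂ)) * (Complex.I * t) ^ m / (Complex.I * t - 1) ^ (m + 1)

/-- The real-valued Cauchy–Laguerre function `α_m = (1/√2)(ψ_m + conj ψ_m)`. -/
noncomputable def cauchyAlpha (m : ℕ) (t : ℝ) : ℂ :=
  (1 / (Real.sqrt 2 : ℂ)) * (cauchyLagPos m t + (starRingEnd ℂ) (cauchyLagPos m t))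

/-- The real-valued Cauchy–Laguerre function `β_m = (1/(i√2))(ψ_m − conj ψ_m)`. -/
noncomputable def cauchyBeta (m : ℕ) (t : ℝ) : ℂ :=
  (1 / (Complex.I * (Real.sqrt 2 : ℂ))) * (cauchyLagPos m t - (starRingEnd ℂ) (cauchyLagPos m t))


theorem cl_split (f : ℕ → ℂ) (N : ℕ) :
    ∑ k ∈ Finset.range (2 * N), f k = ∑ k ∈ Finset.range N, f (2 * k)
      + ∑ k ∈ Finset.range N, f (2 * k + 1) := by
  induction N with
  | zero => simp
  | succ n ih =>
    rw [show 2 * (n + 1) = 2 * n + 1 + 1 by ring, Finset.sum_range_succ, Finset.sum_range_succ, ih,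
      Finset.sum_range_succ, Finset.sum_range_succ]
    ring

theorem cl_binom (n N : ℕ) (h : n + 1 = 2 * N ∨ n + 2 = 2 * N) (t : ℝ) :
    (1 + Complex.I * t) ^ n =
      ((∑ k ∈ Finset.range N, (Nat.choose n (2 * k) : ℝ) * (-1) ^ k * t ^ (2 * k) : ℝ) : ℂ)
      + Complex.I * ((∑ k ∈ Finset.range N,
          (Nat.choose n (2 * k + 1) : ℝ) * (-1) ^ k * t ^ (2 * k + 1) : ℝ) : ℂ) := by
  have h1 : (1 + Complex.I * t) ^ n =
      ∑ k ∈ Finset.range (2 * N), (Complex.I * t) ^ k * (Nat.choose n k : ℂ) := by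
    rw [add_comm, add_pow]
    simp only [one_pow, mul_one]
    rcases h with h | h
    · rw [h]
    · rw [← h, Finset.sum_range_succ _ (n + 1)]
      simp
  rw [h1, cl_split]
  push_cast
  rw [Finset.mul_sum]
  congr 1
  · refine Finset.sum_congr rfl fun k _ => ?_
    rw [mul_pow, pow_mul Complex.I, Complex.I_sq]
    ring
  · refine Finset.sum_congr rfl fun k _ => ?_
    rw [mul_pow, pow_succ Complex.I, pow_mul Complex.I, Complex.I_sq]
    ring

theorem cl_psi (n : ℕ) (t : ℝ) : cauchyLagPos n t =
    (1 / (Real.sqrt 2 : ℂ)) * ((-1) ^ n * (Complex.I * t) ^ n * (1 + Complex.I * t) ^ (n + 1)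
      * (((1 / (t ^ 2 + 1) ^ (n + 1) : ℝ)) : ℂ)) := by
  have h0 : ((t : ℂ) ^ 2 + 1) ≠ 0 := by
    have : (t ^ 2 + 1 : ℝ) ≠ 0 := by positivity
    exact_mod_cast this
  have h1 : (Complex.I * t - 1) * (-(1 + Complex.I * t)) = (t : ℂ) ^ 2 + 1 := by
    linear_combination (-(t : ℂ) ^ 2) * Complex.I_sq
  have h2 : (Complex.I * t - 1) ≠ 0 := by
    intro h
    rw [h, zero_mul] at h1
    exact h0 h1.symm
  have h3 : (Complex.I * t - 1) ^ (n + 1) * ((-1) ^ (n + 1) * (1 + Complex.I * t) ^ (n + 1))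
      = ((t : ℂ) ^ 2 + 1) ^ (n + 1) := by
    rw [← mul_pow, ← mul_pow, ← h1]
    ring
  unfold cauchyLagPos
  push_cast
  rw [← h3, div_eq_iff (pow_ne_zero _ h2)]
  have h4 : (1 + Complex.I * t) ≠ 0 := by
    intro h
    rw [h] at h1
    simp at h1
    exact h0 h1.symm
  have h5 := pow_ne_zero (n + 1) h2
  have h6 := pow_ne_zero (n + 1) h4
  have h7 : ((-1 : ℂ)) ^ n ≠ 0 := pow_ne_zero _ (by norm_num)
  rw [pow_succ (-1 : ℂ) n]
  generalize (Complex.I * t - 1) ^ (n + 1) = a at *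
  generalize (1 + Complex.I * (t : ℂ)) ^ (n + 1) = b at *
  generalize (-1 : ℂ) ^ n = c at *
  generalize (1 / (Real.sqrt 2 : ℂ)) = d at *
  field_simp

theorem cl_sqrt : (1 / (Real.sqrt 2 : ℂ)) * (1 / (Real.sqrt 2 : ℂ)) = 1 / 2 := by
  rw [div_mul_div_comm, ← Complex.ofReal_mul, Real.mul_self_sqrt (by norm_num)]
  norm_num

theorem cl_key (n : ℕ) (t x y : ℝ)
    (h : (-1) ^ n * (Complex.I * t) ^ n * (1 + Complex.I * t) ^ (n + 1) = x + Complex.I * y) :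
    cauchyAlpha n t = ((1 / (t ^ 2 + 1) ^ (n + 1) * x : ℝ) : ℂ) ∧
    cauchyBeta n t = ((1 / (t ^ 2 + 1) ^ (n + 1) * y : ℝ) : ℂ) := by
  unfold cauchyAlpha cauchyBeta
  rw [cl_psi, h]
  generalize 1 / (t ^ 2 + 1) ^ (n + 1) = r
  have hs := cl_sqrt
  have hI : 1 / (Complex.I * (Real.sqrt 2 : ℂ)) = -Complex.I * (1 / (Real.sqrt 2 : ℂ)) := by
    simp [mul_inv_rev, mul_comm]
  have hc : (starRingEnd ℂ) (1 / (Real.sqrt 2 : ℂ)) = 1 / (Real.sqrt 2 : ℂ) := by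
    simp
  rw [hI]
  simp only [map_mul, map_add, hc, Complex.conj_ofReal, Complex.conj_I]
  push_cast
  generalize (1 / (Real.sqrt 2 : ℂ)) = d at *
  constructor
  · linear_combination (2 * (r : ℂ) * x) * hs
  · linear_combination (-2 * Complex.I ^ 2 * (r : ℂ) * y) * hs - (r : ℂ) * y * Complex.I_sq

/-- Explicit real-parameter expressions for the real-valued Cauchy–Laguerre functions. -/
theorem cauchy_real_explicit (m : ℕ) (t : ℝ) :
    cauchyAlpha (2 * m) t =
      (((-1) ^ m * t ^ (2 * m) / (t ^ 2 + 1) ^ (2 * m + 1) *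
        ∑ k ∈ Finset.range (m + 1),
          (Nat.choose (2 * m + 1) (2 * k) : ℝ) * (-1) ^ k * t ^ (2 * k) : ℝ) : ℂ) ∧
    cauchyAlpha (2 * m + 1) t =
      (((-1) ^ m * t ^ (2 * m + 1) / (t ^ 2 + 1) ^ (2 * m + 2) *
        ∑ k ∈ Finset.range (m + 1),
          (Nat.choose (2 * m + 2) (2 * k + 1) : ℝ) * (-1) ^ k * t ^ (2 * k + 1) : ℝ) : ℂ) ∧
    cauchyBeta (2 * m) t =
      (((-1) ^ m * t ^ (2 * m) / (t ^ 2 + 1) ^ (2 * m + 1) *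
        ∑ k ∈ Finset.range (m + 1),
          (Nat.choose (2 * m + 1) (2 * k + 1) : ℝ) * (-1) ^ k * t ^ (2 * k + 1) : ℝ) : ℂ) ∧
    cauchyBeta (2 * m + 1) t =
      (((-1) ^ (m + 1) * t ^ (2 * m + 1) / (t ^ 2 + 1) ^ (2 * m + 2) *
        ∑ k ∈ Finset.range (m + 2),
          (Nat.choose (2 * m + 2) (2 * k) : ℝ) * (-1) ^ k * t ^ (2 * k) : ℝ) : ℂ) := by
  have he := cl_binom (2 * m + 1) (m + 1) (Or.inl (by ring)) t
  have ho := cl_binom (2 * m + 2) (m + 2) (Or.inr (by ring)) t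
  rw [Finset.sum_range_succ (fun k => (Nat.choose (2 * m + 2) (2 * k + 1) : ℝ) * (-1) ^ k *
    t ^ (2 * k + 1)) (m + 1), Nat.choose_eq_zero_of_lt (show 2 * m + 2 < 2 * (m + 1) + 1 by omega),
    Nat.cast_zero, zero_mul, zero_mul, add_zero] at ho
  generalize ∑ k ∈ Finset.range (m + 1),
    (Nat.choose (2 * m + 1) (2 * k) : ℝ) * (-1) ^ k * t ^ (2 * k) = A at *
  generalize ∑ k ∈ Finset.range (m + 1),
    (Nat.choose (2 * m + 1) (2 * k + 1) : ℝ) * (-1) ^ k * t ^ (2 * k + 1) = B at *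
  generalize ∑ k ∈ Finset.range (m + 2),
    (Nat.choose (2 * m + 2) (2 * k) : ℝ) * (-1) ^ k * t ^ (2 * k) = C at *
  generalize ∑ k ∈ Finset.range (m + 1),
    (Nat.choose (2 * m + 2) (2 * k + 1) : ℝ) * (-1) ^ k * t ^ (2 * k + 1) = D at *
  have hi : Complex.I ^ (2 * m) = (-1) ^ m := by rw [pow_mul, Complex.I_sq]
  have hn : (-1 : ℂ) ^ (2 * m) = 1 := by rw [pow_mul]; simp
  obtain ⟨a1, b1⟩ := cl_key (2 * m) t ((-1) ^ m * t ^ (2 * m) * A) ((-1) ^ m * t ^ (2 * m) * B) (by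
    rw [he, mul_pow, hi, hn]; push_cast; ring)
  obtain ⟨a2, b2⟩ := cl_key (2 * m + 1) t ((-1) ^ m * t ^ (2 * m + 1) * D)
    ((-1) ^ (m + 1) * t ^ (2 * m + 1) * C) (by
    rw [show 2 * m + 1 + 1 = 2 * m + 2 by ring, ho, mul_pow, pow_succ Complex.I, hi,
      pow_succ (-1 : ℂ) (2 * m), hn]
    push_cast
    linear_combination (-(-1) ^ m * (t : ℂ) ^ (2 * m + 1) * D) * Complex.I_sq)
  refine ⟨a1.trans ?_, a2.trans ?_, b1.trans ?_, b2.trans ?_⟩ <;> congr 1 <;> ring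
end

section
/- Define for m ∈ ℕ₀ the functions ψ_m(t) = (2√2/3)^{1/2} (6^m m!)^{−1/2} e^{−t²/3} H_m(2t/√3). Then for all t, u ∈ ℝ the series ∑_{m=0}^∞ ψ_m(t) ψ_m(u) converges and equals exp(−(t−u)²/2). -/
open Real Finset

/-- The `m`-th physicists' Hermite polynomial
`H_m(x) = m! ∑_{k=0}^{⌊m/2⌋} ((−1)^k/(k!(m−2k)!)) (2x)^{m−2k}`. -/
noncomputable def hermitePoly (m : ℕ) (x : ℝ) : ℝ :=
  (Nat.factorial m : ℝ) *
    ∑ k ∈ Finset.range (m / 2 + 1),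
      (-1) ^ k / ((Nat.factorial k : ℝ) * (Nat.factorial (m - 2 * k) : ℝ)) *
        (2 * x) ^ (m - 2 * k)

/-- The RKHS basis functions `ψ_m(t) = (2√2/3)^{1/2}(6^m m!)^{−1/2} e^{−t²/3} H_m(2t/√3)`
of the Gaussian kernel. -/
noncomputable def gaussBasis (m : ℕ) (t : ℝ) : ℝ :=
  Real.sqrt (2 * Real.sqrt 2 / 3) * Real.sqrt (1 / (6 ^ m * (Nat.factorial m : ℝ))) *
    Real.exp (-t ^ 2 / 3) * hermitePoly m (2 * t / Real.sqrt 3)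

namespace GK
open MeasureTheory

noncomputable def cc (e : ℂ) (j : ℕ) : ℂ :=
  if Even j then e ^ (j / 2) / (Nat.factorial (j / 2) : ℂ) else 0

noncomputable def hh (e x : ℂ) (m : ℕ) : ℂ :=
  ∑ j ∈ Finset.range (m + 1), cc e j * ((2 * x) ^ (m - j) / (Nat.factorial (m - j) : ℂ))

lemma hs_congr {R : Type} [AddCommMonoid R] [TopologicalSpace R] {f g : ℕ → R} {a b : R}
    (h : HasSum f a) (h1 : ∀ m, g m = f m) (h2 : b = a) : HasSum g b := by
  rw [h2, funext h1]; exact h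

lemma exp_hasSum (w : ℂ) : HasSum (fun k : ℕ => w ^ k / (Nat.factorial k : ℂ)) (Complex.exp w) := by
  rw [Complex.exp_eq_exp_ℂ]
  exact NormedSpace.expSeries_div_hasSum_exp w

lemma cc_hasSum (e s : ℂ) : HasSum (fun j => cc e j * s ^ j) (Complex.exp (e * s ^ 2)) := by
  have hinj : Function.Injective (fun k : ℕ => 2 * k) := fun a b h => by simpa using h
  rw [← hinj.hasSum_iff]
  · refine hs_congr (exp_hasSum (e * s ^ 2)) (fun k => ?_) rfl
    simp only [Function.comp, cc, even_two_mul, if_true]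
    rw [Nat.mul_div_cancel_left k (by norm_num), mul_pow, ← pow_mul]
    ring
  · intro j hj
    have : ¬ Even j := by
      rintro ⟨r, hr⟩
      exact hj ⟨r, by simp; omega⟩
    simp [cc, this]

lemma gen (e x s : ℂ) :
    HasSum (fun m => hh e x m * s ^ m) (Complex.exp (e * s ^ 2) * Complex.exp (2 * x * s)) := by
  have h1 := cc_hasSum e s
  have h2 := exp_hasSum (2 * x * s)
  have := hasSum_sum_range_mul_of_summable_norm h1.summable.norm h2.summable.norm
  rw [h1.tsum_eq, h2.tsum_eq] at this
  refine hs_congr this (fun m => ?_) rfl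
  rw [hh, Finset.sum_mul]
  refine Finset.sum_congr rfl fun j hj => ?_
  have hj' : j ≤ m := by simpa [Nat.lt_succ_iff] using hj
  obtain ⟨n, rfl⟩ := Nat.exists_eq_add_of_le hj'
  rw [Nat.add_sub_cancel_left, mul_pow (2 * x) s, pow_add]
  ring

lemma sum_even (f : ℕ → ℂ) (m : ℕ) :
    ∑ j ∈ Finset.range (m + 1), (if Even j then f j else 0) =
      ∑ k ∈ Finset.range (m / 2 + 1), f (2 * k) := by
  rw [← Finset.sum_filter]
  symm
  refine Finset.sum_bij (fun k _ => 2 * k) ?_ ?_ ?_ ?_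
  · intro k hk
    simp at hk ⊢
    omega
  · intro a _ b _ h
    simpa using h
  · intro j hj
    simp only [Finset.mem_filter, Finset.mem_range] at hj
    obtain ⟨h1, r, hr⟩ := hj
    exact ⟨r, by simp; omega, by omega⟩
  · intros; rfl

lemma herm (m : ℕ) (x : ℝ) : (hermitePoly m x : ℂ) = (Nat.factorial m : ℂ) * hh (-1) x m := by
  have : hh (-1) x m = ∑ j ∈ Finset.range (m + 1), (if Even j then
      (-1) ^ (j / 2) / (Nat.factorial (j / 2) : ℂ) *
        ((2 * x) ^ (m - j) / (Nat.factorial (m - j) : ℂ)) else 0) := by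
    refine Finset.sum_congr rfl fun j _ => ?_
    unfold cc
    split_ifs <;> simp
  rw [this, sum_even, hermitePoly]
  push_cast
  congr 1
  refine Finset.sum_congr rfl fun k _ => ?_
  rw [Nat.mul_div_cancel_left k (by norm_num)]
  rw [div_mul_div_comm, div_mul_eq_mul_div]

lemma norm_le (x : ℝ) (m : ℕ) : ‖hh (-1) x m‖ ≤ (hh 1 (|x| : ℝ) m).re := by
  unfold hh
  refine (norm_sum_le _ _).trans ?_
  rw [Complex.re_sum]
  refine Finset.sum_le_sum fun j _ => le_of_eq ?_
  unfold cc
  split_ifs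
  · have : ((1 : ℂ) ^ (j / 2) / (Nat.factorial (j / 2) : ℂ) *
        ((2 * (|x| : ℝ)) ^ (m - j) / (Nat.factorial (m - j) : ℂ))) =
        (((1 : ℝ) / (Nat.factorial (j / 2) : ℝ) *
        ((2 * |x|) ^ (m - j) / (Nat.factorial (m - j) : ℝ)) : ℝ) : ℂ) := by
      push_cast; simp
    rw [this, Complex.ofReal_re]
    simp
  · simp

lemma integrable_mom (n : ℕ) : Integrable (fun z : ℝ => z ^ n * Real.exp (-z ^ 2)) := by
  have := integrable_rpow_mul_exp_neg_mul_sq (b := 1) one_pos (s := n)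
    (by have : (0 : ℝ) ≤ n := n.cast_nonneg
        linarith)
  simpa using this

lemma mom_zero : ∫ z : ℝ, z ^ 0 * Real.exp (-z ^ 2) = √π := by
  have := integral_gaussian 1
  simpa using this

lemma mom_one : ∫ z : ℝ, z ^ 1 * Real.exp (-z ^ 2) = 0 := by
  have h := integral_eq_zero_of_hasDerivAt_of_integrable
    (f := fun z : ℝ => Real.exp (-z ^ 2)) (f' := fun z : ℝ => (-2) * (z ^ 1 * Real.exp (-z ^ 2)))
    (fun z => by
      have := ((hasDerivAt_pow 2 z).neg).exp
      refine this.congr_deriv ?_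
      push_cast
      simp
      ring) ((integrable_mom 1).const_mul _) (by simpa using integrable_mom 0)
  rw [integral_const_mul] at h
  linarith

lemma mom_succ (n : ℕ) : ∫ z : ℝ, z ^ (n + 2) * Real.exp (-z ^ 2) =
    (n + 1) / 2 * ∫ z : ℝ, z ^ n * Real.exp (-z ^ 2) := by
  have h := integral_eq_zero_of_hasDerivAt_of_integrable
    (f := fun z : ℝ => z ^ (n + 1) * Real.exp (-z ^ 2))
    (f' := fun z : ℝ => (n + 1) * (z ^ n * Real.exp (-z ^ 2)) -
      2 * (z ^ (n + 2) * Real.exp (-z ^ 2)))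
    (fun z => by
      have := (hasDerivAt_pow (n + 1) z).mul (((hasDerivAt_pow 2 z).neg).exp)
      refine this.congr_deriv ?_
      push_cast
      simp
      ring)
    (((integrable_mom n).const_mul _).sub ((integrable_mom (n + 2)).const_mul _))
    (integrable_mom (n + 1))
  rw [integral_sub ((integrable_mom n).const_mul _) ((integrable_mom (n + 2)).const_mul _),
    integral_const_mul, integral_const_mul] at h
  linarith

lemma cc_succ (e : ℂ) (j : ℕ) : cc e (j + 2) * (j + 2) = 2 * e * cc e j := by
  unfold cc
  by_cases h : Even j
  · have h2 : Even (j + 2) := by simpa [Nat.even_add] using h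
    rw [if_pos h, if_pos h2]
    obtain ⟨k, rfl⟩ := h
    have h3 : (k + k + 2) / 2 = k + 1 := by omega
    have h4 : (k + k) / 2 = k := by omega
    rw [h3, h4, Nat.factorial_succ]
    have : (Nat.factorial k : ℂ) ≠ 0 := by exact_mod_cast k.factorial_ne_zero
    have h5 : (k : ℂ) + 1 ≠ 0 := by exact_mod_cast k.succ_ne_zero
    push_cast
    field_simp
    ring
  · have h2 : ¬ Even (j + 2) := by simpa [Nat.even_add] using h
    rw [if_neg h, if_neg h2]; simp

lemma mom (j : ℕ) : (2 * Complex.I) ^ j * ((∫ z : ℝ, z ^ j * Real.exp (-z ^ 2) : ℝ) : ℂ) =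
    (√π : ℝ) * (Nat.factorial j : ℂ) * cc (-1) j := by
  induction j using Nat.twoStepInduction with
  | zero => rw [mom_zero]; simp [cc]
  | one => rw [mom_one]; simp [cc]
  | more j ih _ =>
    rw [mom_succ]
    have h := cc_succ (-1) j
    have hI : Complex.I ^ 2 = -1 := Complex.I_sq
    have h2 : (Nat.factorial (j + 2) : ℂ) = (j + 2) * (j + 1) * Nat.factorial j := by
      rw [Nat.factorial_succ, Nat.factorial_succ]; push_cast; ring
    rw [h2, pow_add, mul_pow 2 Complex.I 2, hI]
    push_cast
    linear_combination (-2 * (j + 1 : ℂ)) * ih - (√π : ℂ) * (j + 1) * (Nat.factorial j) * h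

lemma integral_pow (y : ℝ) (m : ℕ) :
    ∫ z : ℝ, (2 * ((y : ℂ) + Complex.I * z)) ^ m * ((Real.exp (-z ^ 2) : ℝ) : ℂ) =
      (√π : ℝ) * (Nat.factorial m : ℂ) * hh (-1) y m := by
  have h1 : ∀ z : ℝ, (2 * ((y : ℂ) + Complex.I * z)) ^ m * ((Real.exp (-z ^ 2) : ℝ) : ℂ) =
      ∑ j ∈ Finset.range (m + 1), ((2 * Complex.I) ^ j * (2 * y) ^ (m - j) * (m.choose j : ℂ)) *
        ((z ^ j * Real.exp (-z ^ 2) : ℝ) : ℂ) := by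
    intro z
    rw [show 2 * ((y : ℂ) + Complex.I * z) = (2 * Complex.I) * z + 2 * y by ring, add_pow,
      Finset.sum_mul]
    refine Finset.sum_congr rfl fun j _ => ?_
    rw [mul_pow (2 * Complex.I) (z : ℂ)]
    push_cast
    ring
  simp_rw [h1]
  rw [integral_finsetSum _ (fun j _ => by
    exact ((integrable_mom j).ofReal (𝕜 := ℂ)).const_mul _), hh, Finset.mul_sum]
  refine Finset.sum_congr rfl fun j hj => ?_
  have hj' : j ≤ m := by simpa [Nat.lt_succ_iff] using hj
  rw [integral_const_mul]
  erw [integral_ofReal]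
  have h := mom j
  have hc : (Nat.factorial m : ℂ) = m.choose j * Nat.factorial j * Nat.factorial (m - j) := by
    exact_mod_cast (Nat.choose_mul_factorial_mul_factorial hj').symm
  have : (Nat.factorial (m - j) : ℂ) ≠ 0 := by exact_mod_cast (m - j).factorial_ne_zero
  rw [hc]
  field_simp
  linear_combination ((2 * y : ℂ) ^ (m - j) * (m.choose j : ℂ)) * h

lemma hasS (x y z : ℝ) : HasSum (fun m => (hh 1 (|x| : ℝ) m).re *
      (‖((y : ℂ) + Complex.I * z) / 3‖) ^ m * Real.exp (-z ^ 2))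
    (Real.exp (‖((y : ℂ) + Complex.I * z) / 3‖ ^ 2) *
        Real.exp (2 * |x| * ‖((y : ℂ) + Complex.I * z) / 3‖) * Real.exp (-z ^ 2)) := by
  refine HasSum.mul_right _ ?_
  generalize ‖((y : ℂ) + Complex.I * z) / 3‖ = r
  have h := Complex.hasSum_re (gen 1 (|x| : ℝ) (r : ℂ))
  refine hs_congr h (fun m => ?_) ?_
  · rw [← Complex.ofReal_pow, Complex.re_mul_ofReal]
  · rw [show Complex.exp (1 * (r : ℂ) ^ 2) * Complex.exp (2 * (|x| : ℝ) * r) =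
      ((Real.exp (r ^ 2) * Real.exp (2 * |x| * r) : ℝ) : ℂ) by push_cast; simp, Complex.ofReal_re]

lemma mehler (x y : ℝ) : HasSum
    (fun m => hh (-1) x m * hh (-1) y m * (Nat.factorial m : ℂ) / 6 ^ m * (√π : ℝ))
    (∫ z : ℝ, Complex.exp ((-8 / 9 : ℂ) * (z : ℂ) ^ 2 +
      (2 * Complex.I * (x / 3 - y / 9)) * z + (2 * x * y / 3 - y ^ 2 / 9))) := by
  have key := hasSum_integral_of_dominated_convergence (μ := (volume : Measure ℝ))
    (F := fun m z => hh (-1) x m * (((y : ℂ) + Complex.I * z) / 3) ^ m *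
      ((Real.exp (-z ^ 2) : ℝ) : ℂ))
    (f := fun z : ℝ => Complex.exp ((-8 / 9 : ℂ) * (z : ℂ) ^ 2 +
      (2 * Complex.I * (x / 3 - y / 9)) * z + (2 * x * y / 3 - y ^ 2 / 9)))
    (fun m z => (hh 1 (|x| : ℝ) m).re * (‖((y : ℂ) + Complex.I * z) / 3‖) ^ m * Real.exp (-z ^ 2))
    ?_ ?_ ?_ ?_ ?_
  · refine hs_congr key (fun m => ?_) rfl
    have h6 : (6 : ℂ) ^ m = 2 ^ m * 3 ^ m := by rw [← mul_pow]; norm_num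
    have : ∀ z : ℝ, hh (-1) x m * (((y : ℂ) + Complex.I * z) / 3) ^ m *
      ((Real.exp (-z ^ 2) : ℝ) : ℂ) = (hh (-1) x m / 6 ^ m) *
        ((2 * ((y : ℂ) + Complex.I * z)) ^ m * ((Real.exp (-z ^ 2) : ℝ) : ℂ)) := by
      intro z
      rw [h6, mul_pow, div_pow]
      field_simp
    simp_rw [this]
    rw [integral_const_mul, integral_pow]
    ring
  · intro m
    apply Continuous.aestronglyMeasurable
    fun_prop
  · intro m
    refine Filter.Eventually.of_forall fun z => ?_
    rw [norm_mul, norm_mul, norm_pow, Complex.norm_real, Real.norm_of_nonneg (Real.exp_pos _).le]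
    gcongr
    exact norm_le x m
  · refine Filter.Eventually.of_forall fun z => ?_
    exact (hasS x y z).summable
  · have : (fun z : ℝ => ∑' m, (hh 1 (|x| : ℝ) m).re * (‖((y : ℂ) + Complex.I * z) / 3‖) ^ m *
        Real.exp (-z ^ 2)) = fun z : ℝ => Real.exp (‖((y : ℂ) + Complex.I * z) / 3‖ ^ 2) *
        Real.exp (2 * |x| * ‖((y : ℂ) + Complex.I * z) / 3‖) * Real.exp (-z ^ 2) := by
      funext z
      exact (hasS x y z).tsum_eq
    rw [this]
    have hi : Integrable (fun z : ℝ => Real.exp (x ^ 2 + 2 * y ^ 2 / 9) *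
        Real.exp (-(7 / 9) * z ^ 2)) :=
      (integrable_exp_neg_mul_sq (by norm_num)).const_mul _
    refine hi.mono' (Continuous.aestronglyMeasurable (by fun_prop)) ?_
    refine Filter.Eventually.of_forall fun z => ?_
    rw [Real.norm_of_nonneg (by positivity), ← Real.exp_add, ← Real.exp_add, ← Real.exp_add]
    apply Real.exp_le_exp.mpr
    have hn : ‖((y : ℂ) + Complex.I * z) / 3‖ ^ 2 = (y ^ 2 + z ^ 2) / 9 := by
      rw [norm_div, div_pow, ← Complex.normSq_eq_norm_sq, mul_comm, Complex.normSq_add_mul_I]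
      norm_num
    nlinarith [sq_nonneg (|x| - ‖((y : ℂ) + Complex.I * z) / 3‖), sq_abs x]
  · refine Filter.Eventually.of_forall fun z => ?_
    have := (gen (-1) x (((y : ℂ) + Complex.I * z) / 3)).mul_right ((Real.exp (-z ^ 2) : ℝ) : ℂ)
    refine hs_congr this (fun m => rfl) ?_
    rw [Complex.ofReal_exp, ← Complex.exp_add, ← Complex.exp_add]
    congr 1
    push_cast
    linear_combination ((1 : ℂ) / 9 * z ^ 2) * Complex.I_sq

lemma mehler_val (x y : ℝ) : (∫ z : ℝ, Complex.exp ((-8 / 9 : ℂ) * (z : ℂ) ^ 2 +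
      (2 * Complex.I * (x / 3 - y / 9)) * z + (2 * x * y / 3 - y ^ 2 / 9))) =
    ((√π * (3 / (2 * √2)) * Real.exp (-(x ^ 2 + y ^ 2) / 8 + 3 / 4 * x * y) : ℝ) : ℂ) := by
  rw [integral_cexp_quadratic (by norm_num)]
  have h1 : ((π : ℂ) / -(-8 / 9)) ^ (1 / 2 : ℂ) = ((√π * (3 / (2 * √2)) : ℝ) : ℂ) := by
    have : √π * (3 / (2 * √2)) = (π / (8 / 9)) ^ (1 / 2 : ℝ) := by
      rw [← Real.sqrt_eq_rpow, Real.sqrt_div Real.pi_pos.le]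
      rw [show (8 / 9 : ℝ) = (2 * √2 / 3) ^ 2 by
        rw [div_pow, mul_pow, Real.sq_sqrt (by norm_num)]; norm_num, Real.sqrt_sq (by positivity)]
      field_simp
    rw [this, Complex.ofReal_cpow (by positivity)]
    push_cast
    norm_num
  rw [h1]
  push_cast
  congr 2
  linear_combination (9 / 8 * (x / 3 - y / 9) ^ 2 : ℂ) * Complex.I_sq

lemma basis_mul (t u : ℝ) (m : ℕ) : ((gaussBasis m t * gaussBasis m u : ℝ) : ℂ) =
    ((2 * √2 / 3 * Real.exp (-(t ^ 2 + u ^ 2) / 3) / √π : ℝ) : ℂ) *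
    (hh (-1) (2 * t / √3 : ℝ) m * hh (-1) (2 * u / √3 : ℝ) m *
      (Nat.factorial m : ℂ) / 6 ^ m * (√π : ℝ)) := by
  have e1 : gaussBasis m t * gaussBasis m u = (2 * √2 / 3) * (1 / (6 ^ m * (Nat.factorial m : ℝ))) *
      Real.exp (-(t ^ 2 + u ^ 2) / 3) *
      (hermitePoly m (2 * t / √3) * hermitePoly m (2 * u / √3)) := by
    unfold gaussBasis
    have a := Real.mul_self_sqrt (show (0 : ℝ) ≤ 2 * √2 / 3 by positivity)
    have b := Real.mul_self_sqrt (show (0 : ℝ) ≤ 1 / (6 ^ m * (Nat.factorial m : ℝ)) by positivity)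
    rw [show -(t ^ 2 + u ^ 2) / 3 = -t ^ 2 / 3 + -u ^ 2 / 3 by ring, Real.exp_add]
    conv_rhs => rw [← a, ← b]
    ring
  rw [e1, Complex.ofReal_mul, Complex.ofReal_mul (hermitePoly _ _), herm, herm]
  have h : (Nat.factorial m : ℂ) ≠ 0 := by exact_mod_cast m.factorial_ne_zero
  have hp : ((√π : ℝ) : ℂ) ≠ 0 := by
    exact_mod_cast (Real.sqrt_pos.mpr Real.pi_pos).ne'
  generalize hh (-1) (2 * t / √3 : ℝ) m = A
  generalize hh (-1) (2 * u / √3 : ℝ) m = B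
  push_cast
  field_simp

lemma main (t u : ℝ) : HasSum (fun m : ℕ => gaussBasis m t * gaussBasis m u)
    (Real.exp (-(t - u) ^ 2 / 2)) := by
  rw [← Complex.hasSum_ofReal]
  simp_rw [basis_mul]
  have h := (mehler (2 * t / √3) (2 * u / √3)).mul_left
    ((2 * √2 / 3 * Real.exp (-(t ^ 2 + u ^ 2) / 3) / √π : ℝ) : ℂ)
  rw [mehler_val, ← Complex.ofReal_mul] at h
  refine hs_congr h (fun m => rfl) (congrArg _ ?_)
  have hs : √3 ^ 2 = 3 := Real.sq_sqrt (by norm_num)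
  have e : -(t - u) ^ 2 / 2 = -(t ^ 2 + u ^ 2) / 3 + (-((2 * t / √3) ^ 2 + (2 * u / √3) ^ 2) / 8 +
      3 / 4 * (2 * t / √3) * (2 * u / √3)) := by
    field_simp
    rw [hs]
    ring
  rw [e, Real.exp_add]
  have : 0 < √π := Real.sqrt_pos.mpr Real.pi_pos
  generalize Real.exp (-((2 * t / √3) ^ 2 + (2 * u / √3) ^ 2) / 8 +
      3 / 4 * (2 * t / √3) * (2 * u / √3)) = E
  field_simp

end GK

/-- Orthonormal expansion of the Gaussian kernel. -/
theorem gaussian_kernel_expansion (t u : ℝ) :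
    Summable (fun m : ℕ => gaussBasis m t * gaussBasis m u) ∧
      ∑' m : ℕ, gaussBasis m t * gaussBasis m u = Real.exp (-(t - u) ^ 2 / 2) :=
  ⟨(GK.main t u).summable, (GK.main t u).tsum_eq⟩
end

section
/- Define the weight function w(t) = √(2/(3π)) e^{−2t²/3} on ℝ and for m ∈ ℕ₀ the functions ψ_m(t) = (2√2/3)^{1/2} (6^m m!)^{−1/2} e^{−t²/3} H_m(2t/√3). For n ∈ ℕ with n ≥ 1, let e_n(t,u) = ∑_{m=n}^∞ ψ_m(t) ψ_m(u) (the tail of the expansion of the Gaussian kernel exp(−(t−u)²/2)). Then (∫_ℝ ∫_ℝ e_n(t,u)² w(t) w(u) dt du)^{1/2} = (1/√2) · 3^{−n}. -/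
open Real Finset MeasureTheory

/-- The Gaussian weight `w(t) = √(2/(3π)) e^{−2t²/3}`. -/
noncomputable def wGauss (t : ℝ) : ℝ :=
  Real.sqrt (2 / (3 * Real.pi)) * Real.exp (-(2 * t ^ 2) / 3)

/-- The tail `e_n(t,u) = ∑_{m=n}^∞ ψ_m(t)ψ_m(u)` of the Gaussian kernel expansion. -/
noncomputable def gaussTail (n : ℕ) (t u : ℝ) : ℝ :=
  ∑' m : ℕ, gaussBasis (n + m) t * gaussBasis (n + m) u

noncomputable def hT (x : ℝ) (m k : ℕ) : ℝ :=
  if 2 * k ≤ m then (-1) ^ k / ((Nat.factorial k : ℝ) * (Nat.factorial (m - 2 * k) : ℝ)) *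
        (2 * x) ^ (m - 2 * k) else 0

lemma hermitePoly_eq (m N : ℕ) (hN : m < N) (x : ℝ) :
    hermitePoly m x = (Nat.factorial m : ℝ) * ∑ k ∈ Finset.range N, hT x m k := by
  unfold hermitePoly
  congr 1
  have h1 : Finset.range (m / 2 + 1) ⊆ Finset.range N := by
    intro k hk; simp only [Finset.mem_range] at *; omega
  rw [← Finset.sum_subset h1]
  · apply Finset.sum_congr rfl
    intro k hk
    simp only [Finset.mem_range] at hk
    rw [hT, if_pos (by omega)]
  · intro k _ hk
    simp only [Finset.mem_range] at hk
    rw [hT, if_neg (by omega)]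

lemma hT_zero (x : ℝ) (m : ℕ) : ((m : ℝ) + 2) * hT x (m + 2) 0 = 2 * x * hT x (m + 1) 0 := by
  simp only [hT, Nat.mul_zero, Nat.zero_le, if_true, Nat.sub_zero, pow_zero, Nat.factorial_zero]
  rw [Nat.factorial_succ (m + 1)]
  have := Nat.cast_ne_zero (R := ℝ).2 (Nat.factorial_ne_zero (m + 1))
  push_cast
  have h2 : (m : ℝ) + 1 + 1 ≠ 0 := by positivity
  field_simp
  ring

lemma hT_succ (x : ℝ) (m k : ℕ) : ((m : ℝ) + 2) * hT x (m + 2) (k + 1) =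
    2 * x * hT x (m + 1) (k + 1) - 2 * hT x m k := by
  by_cases h : 2 * k ≤ m
  · obtain ⟨j, rfl⟩ := Nat.exists_eq_add_of_le h
    have hk := Nat.cast_ne_zero (R := ℝ).2 (Nat.factorial_ne_zero k)
    have hk1 : (k : ℝ) + 1 ≠ 0 := by positivity
    rcases j with _ | j
    · simp only [hT]
      rw [if_pos (by omega), if_neg (by omega), if_pos (by omega)]
      have e1 : 2 * k + 0 + 2 - 2 * (k + 1) = 0 := by omega
      have e2 : 2 * k + 0 - 2 * k = 0 := by omega
      rw [e1, e2, Nat.factorial_succ k]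
      push_cast
      simp only [Nat.factorial_zero, pow_zero]
      push_cast
      field_simp
      ring
    · simp only [hT]
      rw [if_pos (by omega), if_pos (by omega), if_pos (by omega)]
      have e1 : 2 * k + (j + 1) + 2 - 2 * (k + 1) = j + 1 := by omega
      have e2 : 2 * k + (j + 1) - 2 * k = j + 1 := by omega
      have e3 : 2 * k + (j + 1) + 1 - 2 * (k + 1) = j := by omega
      rw [e1, e2, e3, Nat.factorial_succ k, Nat.factorial_succ j]
      have hj := Nat.cast_ne_zero (R := ℝ).2 (Nat.factorial_ne_zero j)
      have hj1 : (j : ℝ) + 1 ≠ 0 := by positivity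
      push_cast
      field_simp
      ring
  · simp only [hT]
    rw [if_neg (by omega), if_neg (by omega), if_neg h]
    simp

lemma hermitePoly_zero (x : ℝ) : hermitePoly 0 x = 1 := by simp [hermitePoly]
lemma hermitePoly_one (x : ℝ) : hermitePoly 1 x = 2 * x := by simp [hermitePoly]

lemma hermitePoly_rec (m : ℕ) (x : ℝ) : hermitePoly (m + 2) x =
    2 * x * hermitePoly (m + 1) x - 2 * ((m : ℝ) + 1) * hermitePoly m x := by
  rw [hermitePoly_eq (m + 2) (m + 4) (by omega), hermitePoly_eq (m + 1) (m + 4) (by omega),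
    hermitePoly_eq m (m + 3) (by omega)]
  have key : ((m : ℝ) + 2) * ∑ k ∈ Finset.range (m + 4), hT x (m + 2) k =
      2 * x * ∑ k ∈ Finset.range (m + 4), hT x (m + 1) k
        - 2 * ∑ k ∈ Finset.range (m + 3), hT x m k := by
    rw [Finset.sum_range_succ' _ (m + 3), Finset.sum_range_succ' _ (m + 3), mul_add, mul_add,
      hT_zero, Finset.mul_sum, Finset.sum_congr rfl (fun k _ => hT_succ x m k),
      Finset.sum_sub_distrib, ← Finset.mul_sum, ← Finset.mul_sum]
    ring
  rw [Nat.factorial_succ (m + 1), Nat.factorial_succ m]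
  push_cast
  linear_combination ((m : ℝ) + 1) * (Nat.factorial m : ℝ) * key

open Polynomial in
noncomputable def hP : ℕ → Polynomial ℝ
  | 0 => 1
  | m + 1 => 2 * X * hP m - derivative (hP m)

open Polynomial in
lemma hP_deriv (m : ℕ) : derivative (hP (m + 1)) = C (2 * ((m : ℝ) + 1)) * hP m := by
  induction m with
  | zero => simp [hP]; exact (map_ofNat C 2).symm
  | succ m ih =>
    have e : hP (m + 2) = 2 * X * hP (m + 1) - derivative (hP (m + 1)) := rfl
    have e' : derivative (hP m) = 2 * X * hP m - hP (m + 1) := by rw [hP]; ring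
    rw [e, derivative_sub, ih]
    simp only [derivative_mul, derivative_C, derivative_X, derivative_ofNat, e', ih]
    simp only [map_mul, map_add, map_one, map_ofNat, Nat.cast_add, Nat.cast_one]
    ring

open Polynomial in
lemma hermitePoly_eq_eval (m : ℕ) (x : ℝ) : hermitePoly m x = (hP m).eval x := by
  induction m using Nat.strong_induction_on with
  | _ m ih =>
    match m with
    | 0 => simp [hermitePoly_zero, hP]
    | 1 => simp [hermitePoly_one, hP]
    | m + 2 =>
      have e : hP (m + 2) = 2 * X * hP (m + 1) - derivative (hP (m + 1)) := rfl
      rw [hermitePoly_rec, e, hP_deriv, ih m (by omega), ih (m + 1) (by omega)]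
      simp

lemma integrable_pow_gauss (n : ℕ) : Integrable fun x : ℝ => x ^ n * Real.exp (-x ^ 2) := by
  have h := integrable_rpow_mul_exp_neg_mul_sq (b := 1) one_pos (s := n)
    (by have : (0 : ℝ) ≤ n := n.cast_nonneg
        linarith)
  simpa [Real.rpow_natCast] using h

lemma integrable_poly_gauss (p : Polynomial ℝ) :
    Integrable fun x : ℝ => p.eval x * Real.exp (-x ^ 2) := by
  induction p using Polynomial.induction_on' with
  | add p q hp hq =>
    refine (hp.add hq).congr (Filter.Eventually.of_forall fun x => ?_)
    simp [add_mul]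
  | monomial n a => simpa [mul_assoc] using (integrable_pow_gauss n).const_mul a

lemma hasDeriv_hP (m : ℕ) (x : ℝ) : HasDerivAt (fun x => (hP m).eval x * Real.exp (-x ^ 2))
    (-((hP (m + 1)).eval x * Real.exp (-x ^ 2))) x := by
  have h1 := (hP m).hasDerivAt x
  have h2 : HasDerivAt (fun x : ℝ => Real.exp (-x ^ 2)) (Real.exp (-x ^ 2) * (-(2 * x))) x := by
    have := ((hasDerivAt_pow 2 x).neg).exp
    simpa using this
  refine (h1.mul h2).congr_deriv ?_
  simp [hP]
  ring

noncomputable def hI (j k : ℕ) : ℝ := ∫ x : ℝ, (hP j).eval x * (hP k).eval x * Real.exp (-x ^ 2)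

lemma hI_comm (j k : ℕ) : hI j k = hI k j := by
  unfold hI; congr 1; ext x; ring

lemma hI_parts (j k : ℕ) : hI (j + 1) k =
    ∫ x : ℝ, (Polynomial.derivative (hP k)).eval x * ((hP j).eval x * Real.exp (-x ^ 2)) := by
  have h := integral_mul_deriv_eq_deriv_mul_of_integrable
    (u := fun x => (hP k).eval x) (u' := fun x => (Polynomial.derivative (hP k)).eval x)
    (v := fun x => (hP j).eval x * Real.exp (-x ^ 2))
    (v' := fun x => -((hP (j + 1)).eval x * Real.exp (-x ^ 2)))
    (fun x _ => (hP k).hasDerivAt x) (fun x _ => hasDeriv_hP j x)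
    (by
      refine (integrable_poly_gauss (- (hP k * hP (j + 1)))).congr (Filter.Eventually.of_forall ?_)
      intro x; simp; ring)
    (by
      refine (integrable_poly_gauss (Polynomial.derivative (hP k) * hP j)).congr
        (Filter.Eventually.of_forall ?_)
      intro x; simp; ring)
    (by
      refine (integrable_poly_gauss (hP k * hP j)).congr (Filter.Eventually.of_forall ?_)
      intro x; simp; ring)
  rw [← neg_eq_iff_eq_neg, ← integral_neg] at h
  rw [← h, hI]
  congr 1; ext x; ring

lemma hI_succ_zero (j : ℕ) : hI (j + 1) 0 = 0 := by
  rw [hI_parts]; simp [hP]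

lemma hI_succ_succ (j k : ℕ) : hI (j + 1) (k + 1) = 2 * ((k : ℝ) + 1) * hI j k := by
  rw [hI_parts, hP_deriv, hI, ← integral_const_mul]
  congr 1; ext x; simp; ring

lemma hI_zero : hI 0 0 = √π := by
  have := integral_gaussian 1
  simpa [hI, hP] using this

lemma hI_eq (j k : ℕ) : hI j k = if j = k then 2 ^ j * (Nat.factorial j : ℝ) * √π else 0 := by
  induction j generalizing k with
  | zero =>
    cases k with
    | zero => simp [hI_zero]
    | succ k => rw [hI_comm, hI_succ_zero]; simp
  | succ j ih =>
    cases k with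
    | zero => rw [hI_succ_zero]; simp
    | succ k =>
      rw [hI_succ_succ, ih]
      by_cases h : j = k
      · subst h; simp [Nat.factorial_succ]; ring
      · simp [h]


lemma tail_aux {α : Type*} [MeasurableSpace α] {μ : Measure α} {ι : Type*} [Countable ι]
    {F : ι → α → ℝ} (hF : ∀ i, Integrable (F i) μ)
    (hs : Summable fun i => ∫ a, ‖F i a‖ ∂μ) :
    (∀ᵐ a ∂μ, Summable fun i => ‖F i a‖) ∧ Integrable (fun a => ∑' i, F i a) μ := by
  have e (i : ι) : ∫⁻ a, ‖F i a‖ₑ ∂μ = ‖∫ a, ‖F i a‖ ∂μ‖ₑ := by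
    rw [← ofReal_integral_norm_eq_lintegral_enorm (hF i),
      Real.enorm_of_nonneg (integral_nonneg fun a => norm_nonneg _)]
  have fin : ∑' i, ∫⁻ a, ‖F i a‖ₑ ∂μ ≠ ⊤ := by
    rw [funext e]
    exact tsum_enorm_ne_top_iff_summable_norm.2 hs.norm
  have fin' : ∫⁻ a, ∑' i, ‖F i a‖ₑ ∂μ ≠ ⊤ := by
    rwa [lintegral_tsum (fun i => (hF i).1.enorm)]
  have hae : ∀ᵐ a ∂μ, Summable fun i => ‖F i a‖ := by
    filter_upwards [ae_lt_top' (AEMeasurable.tsum fun i => (hF i).1.enorm) fin'] with a ha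
    exact tsum_enorm_ne_top_iff_summable_norm.1 ha.ne
  refine ⟨hae, ?_, ?_⟩
  · apply AEMeasurable.aestronglyMeasurable
    refine aemeasurable_of_tendsto_metrizable_ae (Filter.atTop : Filter (Finset ι))
      (f := fun s a => ∑ i ∈ s, F i a)
      (fun s => Finset.aemeasurable_fun_sum s fun i _ => (hF i).1.aemeasurable) ?_
    filter_upwards [hae] with a ha
    exact ha.of_norm.hasSum
  · rw [hasFiniteIntegral_iff_enorm]
    refine lt_of_le_of_lt (lintegral_mono fun a => enorm_tsum_le_tsum_enorm) fin'.lt_top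

noncomputable def gG (j k : ℕ) (t : ℝ) : ℝ := gaussBasis j t * gaussBasis k t * wGauss t

noncomputable def gA : ℝ := (2 * √2 / 3) * √(2 / (3 * π))

lemma gG_eq (j k : ℕ) (t : ℝ) : gG j k t =
    gA * √(1 / (6 ^ j * (Nat.factorial j : ℝ))) * √(1 / (6 ^ k * (Nat.factorial k : ℝ))) *
    ((fun x => (hP j).eval x * (hP k).eval x * Real.exp (-x ^ 2)) (2 / √3 * t)) := by
  have e1 : 2 * t / √3 = 2 / √3 * t := by ring
  have e2 : Real.exp (-(2 / √3 * t) ^ 2) =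
      Real.exp (-t ^ 2 / 3) * Real.exp (-t ^ 2 / 3) * Real.exp (-(2 * t ^ 2) / 3) := by
    rw [← Real.exp_add, ← Real.exp_add, mul_pow, div_pow, Real.sq_sqrt (by norm_num)]
    congr 1; ring
  have e3 : √(2 * √2 / 3) * √(2 * √2 / 3) = 2 * √2 / 3 := Real.mul_self_sqrt (by positivity)
  simp only [gG, gaussBasis, wGauss, hermitePoly_eq_eval, e1, e2, gA]
  generalize √(2 * √2 / 3) = s at *
  rw [← e3]
  ring

lemma gG_integrable (j k : ℕ) : Integrable (gG j k) := by
  have h : Integrable (fun x => (hP j).eval x * (hP k).eval x * Real.exp (-x ^ 2)) := by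
    simpa using integrable_poly_gauss (hP j * hP k)
  have h2 := (h.comp_mul_left' (R := 2 / √3) (by positivity)).const_mul
    (gA * √(1 / (6 ^ j * (Nat.factorial j : ℝ))) * √(1 / (6 ^ k * (Nat.factorial k : ℝ))))
  exact h2.congr (Filter.Eventually.of_forall fun t => (gG_eq j k t).symm)

lemma gG_integral (j k : ℕ) : ∫ t, gG j k t = if j = k then (2 / 3) / 3 ^ j else 0 := by
  have h : ∫ t, gG j k t = gA * √(1 / (6 ^ j * (Nat.factorial j : ℝ))) *
      √(1 / (6 ^ k * (Nat.factorial k : ℝ))) * (√3 / 2 * hI j k) := by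
    rw [funext (gG_eq j k), integral_const_mul,
      Measure.integral_comp_mul_left
        (fun x => (hP j).eval x * (hP k).eval x * Real.exp (-x ^ 2)) (2 / √3), hI,
      abs_of_nonneg (by positivity), inv_div, smul_eq_mul]
  rw [h, hI_eq]
  split_ifs with hjk
  · subst hjk
    have hf : (0 : ℝ) < Nat.factorial j := by exact_mod_cast Nat.factorial_pos j
    have e1 : √(1 / (6 ^ j * (Nat.factorial j : ℝ))) * √(1 / (6 ^ j * (Nat.factorial j : ℝ)))
      = 1 / (6 ^ j * (Nat.factorial j : ℝ)) := Real.mul_self_sqrt (by positivity)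
    have e2 : √(2 / (3 * π)) = √2 / (√3 * √π) := by
      rw [Real.sqrt_div (by norm_num), Real.sqrt_mul (by norm_num)]
    have e3 : √2 * √2 = (2 : ℝ) := Real.mul_self_sqrt (by norm_num)
    have e4 : (6 : ℝ) ^ j = 2 ^ j * 3 ^ j := by rw [← mul_pow]; norm_num
    have hp : √π ≠ 0 := by positivity
    have h3 : √(3 : ℝ) ≠ 0 := by positivity
    rw [mul_assoc gA, e1, gA, e2, e4]
    field_simp
    linear_combination e3
  · simp

lemma wGauss_pos (t : ℝ) : 0 < wGauss t := by unfold wGauss; positivity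

lemma gG_abs (j k : ℕ) : ∫ t, ‖gG j k t‖ ≤ (2 / 3) / (√3 ^ j * √3 ^ k) := by
  have hb (t : ℝ) : √3 ^ j * √3 ^ k * ‖gG j k t‖ ≤
      (1 / 2) * (3 ^ j * gG j j t) + (1 / 2) * (3 ^ k * gG k k t) := by
    have hw := wGauss_pos t
    have ej : (3 : ℝ) ^ j = √3 ^ j * √3 ^ j := by
      rw [← mul_pow, Real.mul_self_sqrt (by norm_num)]
    have ek : (3 : ℝ) ^ k = √3 ^ k * √3 ^ k := by
      rw [← mul_pow, Real.mul_self_sqrt (by norm_num)]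
    rw [ej, ek]
    simp only [gG, norm_mul, Real.norm_eq_abs, abs_of_pos hw]
    have h := mul_nonneg (sq_nonneg (√3 ^ j * |gaussBasis j t| - √3 ^ k * |gaussBasis k t|)) hw.le
    have a1 := abs_mul_abs_self (gaussBasis j t)
    have a2 := abs_mul_abs_self (gaussBasis k t)
    rw [← a1, ← a2]
    nlinarith
  have h := integral_mono ((gG_integrable j k).norm.const_mul (√3 ^ j * √3 ^ k))
    ((((gG_integrable j j).const_mul (3 ^ j)).const_mul (1 / 2)).add
      (((gG_integrable k k).const_mul (3 ^ k)).const_mul (1 / 2))) hb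
  simp only [Pi.add_apply] at h
  rw [integral_add (((gG_integrable j j).const_mul (3 ^ j)).const_mul (1 / 2))
      (((gG_integrable k k).const_mul (3 ^ k)).const_mul (1 / 2))] at h
  simp only [integral_const_mul, gG_integral, if_true] at h
  rw [le_div_iff₀ (by positivity)]
  have c (i : ℕ) : (3 : ℝ) ^ i * (2 / 3 / 3 ^ i) = 2 / 3 := by field_simp
  rw [c, c] at h
  linarith

noncomputable def gF (n : ℕ) (p : ℕ × ℕ) (z : ℝ × ℝ) : ℝ :=
  gG (n + p.1) (n + p.2) z.1 * gG (n + p.1) (n + p.2) z.2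

lemma gF_integrable (n : ℕ) (p : ℕ × ℕ) : Integrable (gF n p) (volume.prod volume) :=
  (gG_integrable _ _).mul_prod (gG_integrable _ _)

lemma gF_summable (n : ℕ) :
    Summable fun p => ∫ z, ‖gF n p z‖ ∂((volume : Measure ℝ).prod (volume : Measure ℝ)) := by
  have hg : Summable fun i : ℕ => ((1 : ℝ) / 3) ^ i :=
    summable_geometric_of_lt_one (by norm_num) (by norm_num)
  have hgg : Summable fun p : ℕ × ℕ => ((1 : ℝ) / 3) ^ p.1 * ((1 : ℝ) / 3) ^ p.2 :=
    summable_mul_of_summable_norm hg.norm hg.norm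
  refine hgg.of_nonneg_of_le (fun p => integral_nonneg fun z => norm_nonneg _) fun p => ?_
  simp only [gF, norm_mul]
  rw [integral_prod_mul (fun t => ‖gG (n + p.1) (n + p.2) t‖)
    (fun t => ‖gG (n + p.1) (n + p.2) t‖)]
  have h := gG_abs (n + p.1) (n + p.2)
  have h0 : 0 ≤ ∫ t, ‖gG (n + p.1) (n + p.2) t‖ := integral_nonneg fun z => norm_nonneg _
  have e (i : ℕ) : √3 ^ i * √3 ^ i = (3 : ℝ) ^ i := by
    rw [← mul_pow, Real.mul_self_sqrt (by norm_num)]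
  have h1 : (2 / 3 : ℝ) / (√3 ^ (n + p.1) * √3 ^ (n + p.2)) ≤ 1 / (√3 ^ p.1 * √3 ^ p.2) := by
    have s1 : (1 : ℝ) ≤ √3 := by rw [Real.one_le_sqrt]; norm_num
    gcongr
    · norm_num
    · omega
    · omega
  have h2 := h.trans h1
  refine (mul_le_mul h2 h2 h0 (h0.trans h2)).trans_eq ?_
  rw [one_div_pow, one_div_pow, ← e, ← e]
  field_simp

lemma gF_tsum (n : ℕ) (t u : ℝ) (h : Summable fun p => ‖gF n p (t, u)‖) :
    ∑' p, gF n p (t, u) = gaussTail n t u ^ 2 * wGauss t * wGauss u := by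
  set a : ℕ → ℝ := fun m => gaussBasis (n + m) t * gaussBasis (n + m) u with ha
  have hW : 0 < wGauss t * wGauss u := mul_pos (wGauss_pos t) (wGauss_pos u)
  have e (p : ℕ × ℕ) : gF n p (t, u) = a p.1 * a p.2 * (wGauss t * wGauss u) := by
    simp only [gF, gG, ha]; ring
  have hs : Summable fun m => ‖a m‖ := by
    by_cases hz : ∀ m, a m = 0
    · simp [hz, summable_zero]
    · push Not at hz
      obtain ⟨m, hm⟩ := hz
      have h1 : Summable fun k => ‖gF n (m, k) (t, u)‖ := h.prod_factor m
      have h2 := h1.mul_left ((‖a m‖ * ‖wGauss t * wGauss u‖)⁻¹)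
      refine h2.congr fun k => ?_
      have hm' : ‖a m‖ ≠ 0 := norm_ne_zero_iff.2 hm
      have hW' : ‖wGauss t * wGauss u‖ ≠ 0 := norm_ne_zero_iff.2 hW.ne'
      have e' : ‖gF n (m, k) (t, u)‖ = ‖a m‖ * ‖a k‖ * ‖wGauss t * wGauss u‖ := by
        rw [e, norm_mul _ (wGauss t * wGauss u), norm_mul (a (m, k).1) (a (m, k).2)]
      rw [e']
      generalize ‖wGauss t * wGauss u‖ = w at *
      generalize ‖a m‖ = b at *
      field_simp
  have ht : gaussTail n t u = ∑' m, a m := rfl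
  rw [funext e, tsum_mul_right, ht, sq, tsum_mul_tsum_of_summable_norm hs hs, mul_assoc]

lemma gF_integral (n : ℕ) (p : ℕ × ℕ) :
    ∫ z, gF n p z ∂((volume : Measure ℝ).prod (volume : Measure ℝ)) =
      if p.1 = p.2 then (4 / 9) * (1 / 9) ^ n * (1 / 9) ^ p.1 else 0 := by
  unfold gF
  rw [integral_prod_mul (gG (n + p.1) (n + p.2)) (gG (n + p.1) (n + p.2)), gG_integral]
  by_cases h : p.1 = p.2
  · rw [if_pos (by omega), if_pos h, one_div_pow, one_div_pow]
    have e (i : ℕ) : (9 : ℝ) ^ i = 3 ^ i * 3 ^ i := by rw [← mul_pow]; norm_num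
    rw [e, e, pow_add]
    field_simp
    norm_num
  · rw [if_neg (by omega), if_neg h]; simp

lemma main_integral (n : ℕ) :
    ∫ t : ℝ, ∫ u : ℝ, gaussTail n t u ^ 2 * wGauss t * wGauss u = 1 / 2 * (1 / 9) ^ n := by
  obtain ⟨hae, hint⟩ := tail_aux (gF_integrable n) (gF_summable n)
  have hcongr : (fun z => ∑' p, gF n p z) =ᵐ[(volume : Measure ℝ).prod (volume : Measure ℝ)]
      fun z => gaussTail n z.1 z.2 ^ 2 * wGauss z.1 * wGauss z.2 := by
    filter_upwards [hae] with z hz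
    exact gF_tsum n z.1 z.2 hz
  have h1 := integral_prod _ (hint.congr hcongr)
  have h2 := hasSum_integral_of_summable_integral_norm (gF_integrable n) (gF_summable n)
  rw [integral_congr_ae hcongr, h1] at h2
  simp only [gF_integral] at h2
  rw [← h2.tsum_eq, h2.summable.tsum_prod]
  have e (j : ℕ) : ∑' k : ℕ, (if j = k then (4 / 9 : ℝ) * (1 / 9) ^ n * (1 / 9) ^ j else 0) =
      (4 / 9 : ℝ) * (1 / 9) ^ n * (1 / 9) ^ j := by
    rw [tsum_eq_single j (fun k hk => if_neg hk.symm), if_pos rfl]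
  simp only [e]
  rw [tsum_mul_left, tsum_geometric_of_lt_one (by norm_num) (by norm_num)]
  ring

/-- Hilbert–Schmidt norm of the truncation error of the Gaussian expansion. -/
theorem gaussian_truncation_error (n : ℕ) (hn : 1 ≤ n) :
    Real.sqrt (∫ t : ℝ, ∫ u : ℝ, gaussTail n t u ^ 2 * wGauss t * wGauss u) =
      (1 / Real.sqrt 2) * (1 / 3 ^ n) := by
  rw [main_integral, Real.sqrt_mul (by norm_num), Real.sqrt_div (by norm_num), Real.sqrt_one]
  congr 1
  rw [Real.sqrt_eq_iff_mul_self_eq (by positivity) (by positivity), one_div_pow]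
  have e : (9 : ℝ) ^ n = 3 ^ n * 3 ^ n := by rw [← mul_pow]; norm_num
  rw [e]; field_simp
end
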